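/- Let ℓ ≥ 1 and w be integers with 4ℓm − w² > 0, and let k, m, c, φ be as in the context. Then the integral ∫_{u∈[0,1]} ∫_{v∈(0,∞)} ∫_{x∈[0,1]} ∫_{y∈ℝ} φ(τ,z) · conj( ((4ℓm−w²) − (m(2k−1)/6)E₂(τ)) e^{2πi(ℓτ+wz)} ) · v^{k+2} e^{−4πmy²/v} · (du dv dx dy)/v³ converges absolutely and equals (m^k Γ(k+1/2)/(2π^{k+1/2})) · [ ((4ℓm−w²) − m(2k−1)/6) · c(ℓ,w)/(4ℓm−w²)^{k+1/2} + 4m(2k−1) ∑_{p≥1} σ₁(p) c(ℓ+p,w)/(4(ℓ+p)m−w²)^{k+1/2} ]. (Here ((4ℓm−w²) − (m(2k−1)/6)E₂(τ)) e^{2πi(ℓτ+wz)} is the value of (L_m − (m(2k−1)/6)E₂)(q^ℓζ^w) with L_m = 4mD_τ − D_z² the heat operator.) -/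

import Mathlib

noncomputable section

open Complex MeasureTheory Set
open scoped ComplexConjugate

/-- `e w = exp (2 π i w)`. -/
def e (w : ℂ) : ℂ := Complex.exp (2 * (Real.pi : ℂ) * Complex.I * w)

/-- The monomial `q^n ζ^r`, i.e. `(τ, z) ↦ e^{2πi(nτ + rz)}`. -/
def Qmon (n : ℕ) (r : ℤ) (τ z : ℂ) : ℂ := e ((n : ℂ) * τ + (r : ℂ) * z)

/-- `σ₁(n)`, the sum of the positive divisors of `n`. -/
def sigma1 (n : ℕ) : ℕ := ∑ d ∈ n.divisors, d

/-- The weight-2 Eisenstein series `E₂(τ) = 1 - 24 ∑_{n ≥ 1} σ₁(n) e^{2πinτ}`. -/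
def E2 (τ : ℂ) : ℂ := 1 - 24 * ∑' n : ℕ, (sigma1 (n + 1) : ℂ) * e (((n : ℂ) + 1) * τ)

/-- The deformed Eisenstein series
`J₁(τ,z) = ζ/(ζ-1) - 1/2 - ∑_{a,b ≥ 1} (ζ^a - ζ^{-a}) q^{ab}`. -/
def J1 (τ z : ℂ) : ℂ :=
  e z / (e z - 1) - 1 / 2 -
    ∑' p : ℕ × ℕ, (e (((p.1 : ℂ) + 1) * z) - e (-(((p.1 : ℂ) + 1) * z))) *
      e (((p.1 : ℂ) + 1) * ((p.2 : ℂ) + 1) * τ)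

/-- The deformed Eisenstein series
`J₂(τ,z) = 1/6 - 2 ∑_{a,b ≥ 1} b (ζ^a + ζ^{-a}) q^{ab}`. -/
def J2 (τ z : ℂ) : ℂ :=
  1 / 6 - 2 * ∑' p : ℕ × ℕ, ((p.2 : ℂ) + 1) *
      (e (((p.1 : ℂ) + 1) * z) + e (-(((p.1 : ℂ) + 1) * z))) *
      e (((p.1 : ℂ) + 1) * ((p.2 : ℂ) + 1) * τ)

/-- `D_τ = (1/2πi) ∂/∂τ`. -/
def Dt (φ : ℂ → ℂ → ℂ) : ℂ → ℂ → ℂ :=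
  fun τ z => (1 / (2 * (Real.pi : ℂ) * Complex.I)) * deriv (fun t => φ t z) τ

/-- `D_z = (1/2πi) ∂/∂z`. -/
def Dz (φ : ℂ → ℂ → ℂ) : ℂ → ℂ → ℂ :=
  fun τ z => (1 / (2 * (Real.pi : ℂ) * Complex.I)) * deriv (fun w => φ τ w) z

/-- The slash action `φ ↦ φ|_{k,m} γ` for `γ = ((a,b;c,d),(λ,μ)) ∈ Γ^J`. -/
def slash (k m : ℤ) (a b c d lam mu : ℤ) (φ : ℂ → ℂ → ℂ) (τ z : ℂ) : ℂ :=
  ((c : ℂ) * τ + (d : ℂ)) ^ (-k) *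
    e ((m : ℂ) * (-(c : ℂ) * (z + (lam : ℂ) * τ + (mu : ℂ)) ^ 2 / ((c : ℂ) * τ + (d : ℂ)) +
        (lam : ℂ) ^ 2 * τ + 2 * (lam : ℂ) * z)) *
    φ (((a : ℂ) * τ + (b : ℂ)) / ((c : ℂ) * τ + (d : ℂ)))
      ((z + (lam : ℂ) * τ + (mu : ℂ)) / ((c : ℂ) * τ + (d : ℂ)))

/-- The domain `D' = {(τ,z) : 0 < Im τ, |Im z| < Im τ, e^{2πiz} ≠ 1}`. -/
def D' : Set (ℂ × ℂ) := {p | 0 < p.1.im ∧ |p.2.im| < p.1.im ∧ e p.2 ≠ 1}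

/-- The Oberdieck derivative `Oφ = D_τφ - (k/12)E₂φ - J₁D_zφ + mJ₂φ` of weight `k`, index `m`. -/
def Ober (k m : ℕ) (φ : ℂ → ℂ → ℂ) : ℂ → ℂ → ℂ :=
  fun τ z => Dt φ τ z - ((k : ℂ) / 12) * E2 τ * φ τ z - J1 τ z * Dz φ τ z +
    (m : ℂ) * J2 τ z * φ τ z

/-- The heat operator `L_m = 4m D_τ - D_z²`. -/
def Heat (m : ℕ) (φ : ℂ → ℂ → ℂ) : ℂ → ℂ → ℂ :=
  fun τ z => 4 * (m : ℂ) * Dt φ τ z - Dz (Dz φ) τ z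

/-- The modified heat operator `L_{k,m} = L_m - (m(2k-1)/6) E₂`. -/
def HeatE (k m : ℕ) (φ : ℂ → ℂ → ℂ) : ℂ → ℂ → ℂ :=
  fun τ z => Heat m φ τ z - (m : ℂ) * (2 * (k : ℂ) - 1) / 6 * E2 τ * φ τ z

/-- The Jacobi–Serre derivative of weight `k` and index `m`. -/
def JSerre (k m : ℕ) (φ : ℂ → ℂ → ℂ) : ℂ → ℂ → ℂ :=
  fun τ z => Dt φ τ z - ((k : ℂ) / 12) * E2 τ * φ τ z +
    (1 / (1 - 4 * (m : ℂ))) *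
      (Dz (Dz φ) τ z - J1 τ z * Dz φ τ z + (m : ℂ) * J2 τ z * φ τ z -
        ((m : ℂ) / 6) * E2 τ * φ τ z)

/-- The error function `erf a = (2/√π) ∫₀^a e^{-t²} dt`. -/
def erf (a : ℝ) : ℝ := 2 / Real.sqrt Real.pi * ∫ t in (0 : ℝ)..a, Real.exp (-t ^ 2)

/-- Euler's integral for `₂F₁(1/2, k+1; 3/2; x)`:
`F_k(x) = (1/2) ∫₀¹ t^{-1/2} (1 - xt)^{-(k+1)} dt`. -/
def Fk (k x : ℝ) : ℝ := (1 / 2) * ∫ t in (0 : ℝ)..1, t ^ (-(1 : ℝ) / 2) * (1 - x * t) ^ (-(k + 1))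

/-- The integration region `(u,v,x,y) ∈ [0,1] × (0,∞) × [0,1] × ℝ`. -/
def Reg : Set (ℝ × ℝ × ℝ × ℝ) := Icc 0 1 ×ˢ Ioi 0 ×ˢ Icc 0 1 ×ˢ univ

/-- The Fourier series `φ(τ,z) = ∑_{n,r} c(n,r) q^n ζ^r`. -/
def phiF (c : ℕ → ℤ → ℂ) (τ z : ℂ) : ℂ :=
  ∑' p : ℕ × ℤ, c p.1 p.2 * e ((p.1 : ℂ) * τ + (p.2 : ℂ) * z)

/-- The integrand of STATEMENT 11, as a function of `(u, v, x, y)` with `τ = u + iv`,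
`z = x + iy`: `φ(τ,z) ⬝ conj((L_m - (m(2k-1)/6)E₂)(q^ℓζ^w)(τ,z)) v^{k+2} e^{-4πmy²/v} / v³`. -/
def G11 (k m ℓ : ℕ) (w : ℤ) (c : ℕ → ℤ → ℂ) (p : ℝ × ℝ × ℝ × ℝ) : ℂ :=
  phiF c ⟨p.1, p.2.1⟩ ⟨p.2.2.1, p.2.2.2⟩ *
    conj (((4 * (ℓ : ℂ) * (m : ℂ) - (w : ℂ) ^ 2) -
        (m : ℂ) * (2 * (k : ℂ) - 1) / 6 * E2 ⟨p.1, p.2.1⟩) *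
      Qmon ℓ w ⟨p.1, p.2.1⟩ ⟨p.2.2.1, p.2.2.2⟩) *
    (p.2.1 : ℂ) ^ (k + 2) * Real.exp (-4 * Real.pi * m * p.2.2.2 ^ 2 / p.2.1) /
    (p.2.1 : ℂ) ^ 3

theorem norm_tsum_mul_unimodular_le {ι X : Type*} {χ : ι → X → ℂ} (hχ1 : ∀ p x, ‖χ p x‖ = 1)
    {a : ι → ℂ} (ha : Summable fun p => ‖a p‖) (x : X) : ‖∑' p, a p * χ p x‖ ≤ ∑' p, ‖a p‖ := by
  have h : ∀ p, ‖a p * χ p x‖ = ‖a p‖ := fun p => by rw [norm_mul, hχ1, mul_one]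
  simpa only [h] using norm_tsum_le_tsum_norm (f := fun p => a p * χ p x)
    (by simpa only [h] using ha)

section Orthonormal

variable {ι X Y : Type*} [MeasurableSpace X] [MeasurableSpace Y] {ν : Measure X} {P : Measure Y}
  {χ : ι → X → ℂ} {A B : ι → Y → ℂ}

theorem integral_tsum_mul_conj_tsum [Countable ι] [DecidableEq ι] [IsProbabilityMeasure ν]
    (hχm : ∀ p, Measurable (χ p)) (hχ1 : ∀ p x, ‖χ p x‖ = 1)
    (hort : ∀ p q, ∫ x, χ p x * conj (χ q x) ∂ν = if p = q then 1 else 0)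
    {a b : ι → ℂ} (ha : Summable fun p => ‖a p‖) (hb : Summable fun p => ‖b p‖) :
    ∫ x, (∑' p, a p * χ p x) * conj (∑' p, b p * χ p x) ∂ν = ∑' p, a p * conj (b p) := by
  have hna : ∀ p x, ‖a p * χ p x‖ = ‖a p‖ := fun p x => by rw [norm_mul, hχ1, mul_one]
  have hnb : ∀ p x, ‖conj (b p * χ p x)‖ = ‖b p‖ := fun p x => by
    rw [RCLike.norm_conj, norm_mul, hχ1, mul_one]
  have hab : Summable fun z : ι × ι => ‖a z.1‖ * ‖b z.2‖ :=
    ha.mul_of_nonneg hb (fun _ => norm_nonneg _) (fun _ => norm_nonneg _)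
  have hexp : ∀ x, (∑' p, a p * χ p x) * conj (∑' p, b p * χ p x) =
      ∑' z : ι × ι, (a z.1 * χ z.1 x) * conj (b z.2 * χ z.2 x) := fun x => by
    rw [Complex.conj_tsum]
    exact tsum_mul_tsum_of_summable_norm (by simpa only [hna] using ha)
      (by simpa only [hnb] using hb)
  have hF : ∀ z : ι × ι, Integrable
      (fun x => (a z.1 * χ z.1 x) * conj (b z.2 * χ z.2 x)) ν := fun z => by
    refine Integrable.of_bound (C := ‖a z.1‖ * ‖b z.2‖) ?_ ?_
    · exact (((hχm _).const_mul _).mul (Complex.continuous_conj.measurable.comp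
        ((hχm _).const_mul _))).aestronglyMeasurable
    · filter_upwards with x
      rw [norm_mul, hna, hnb]
  have hval : ∀ z : ι × ι, ∫ x, (a z.1 * χ z.1 x) * conj (b z.2 * χ z.2 x) ∂ν =
      if z.1 = z.2 then a z.1 * conj (b z.2) else 0 := fun z => by
    have : ∀ x, (a z.1 * χ z.1 x) * conj (b z.2 * χ z.2 x) =
        (a z.1 * conj (b z.2)) * (χ z.1 x * conj (χ z.2 x)) := fun x => by
      rw [map_mul]; ring
    simp_rw [this]
    rw [integral_const_mul, hort]
    split_ifs <;> simp
  have hS : Summable fun z : ι × ι => ∫ x, ‖(a z.1 * χ z.1 x) * conj (b z.2 * χ z.2 x)‖ ∂ν := by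
    simpa only [norm_mul, RCLike.norm_conj, hχ1, mul_one, integral_const, probReal_univ,
      one_smul] using hab
  have hsum := hasSum_integral_of_summable_integral_norm hF hS
  simp_rw [hexp]
  rw [← hsum.tsum_eq]
  simp_rw [hval]
  have hs2 : Summable fun z : ι × ι => if z.1 = z.2 then a z.1 * conj (b z.2) else 0 := by
    simpa only [hval] using hsum.summable
  rw [hs2.tsum_prod]
  refine tsum_congr fun p => ?_
  rw [tsum_eq_single p (fun q hq => by simp [Ne.symm hq])]
  simp

theorem integrable_norm_sq_tsum [Countable ι] [DecidableEq ι] [IsProbabilityMeasure ν] [SFinite P]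
    (hχm : ∀ p, Measurable (χ p)) (hχ1 : ∀ p x, ‖χ p x‖ = 1)
    (hort : ∀ p q, ∫ x, χ p x * conj (χ q x) ∂ν = if p = q then 1 else 0)
    (hAm : ∀ p, Measurable (A p)) (hA : ∀ᵐ y ∂P, Summable fun p => ‖A p y‖)
    (hA2 : ∀ p, Integrable (fun y => ‖A p y‖ ^ 2) P)
    (hA2s : Summable fun p => ∫ y, ‖A p y‖ ^ 2 ∂P) :
    Integrable (fun z : X × Y => ‖∑' p, A p z.2 * χ p z.1‖ ^ 2) (ν.prod P) := by
  have hm : Measurable fun z : X × Y => ‖∑' p, A p z.2 * χ p z.1‖ ^ 2 :=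
    (Measurable.tsum fun p => ((hAm p).comp measurable_snd).mul
      ((hχm p).comp measurable_fst)).norm.pow_const 2
  refine ⟨hm.aestronglyMeasurable, ?_⟩
  rw [hasFiniteIntegral_iff_ofReal (Filter.Eventually.of_forall fun z => by positivity),
    lintegral_prod_symm' _ hm.ennreal_ofReal]
  have hinner : ∀ᵐ y ∂P, ∫⁻ x, ENNReal.ofReal (‖∑' p, A p y * χ p x‖ ^ 2) ∂ν =
      ∑' p, ENNReal.ofReal (‖A p y‖ ^ 2) := by
    filter_upwards [hA] with y hy
    have hc : ∀ z : ℂ, z * conj z = ((‖z‖ ^ 2 : ℝ) : ℂ) := fun z => by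
      rw [Complex.mul_conj, Complex.normSq_eq_norm_sq]
    have h := integral_tsum_mul_conj_tsum hχm hχ1 hort hy hy
    simp_rw [hc] at h
    rw [integral_complex_ofReal, ← Complex.ofReal_tsum, Complex.ofReal_inj] at h
    have hy2 : Summable fun p => ‖A p y‖ ^ 2 := by
      have := hy.mul_of_nonneg hy (fun _ => norm_nonneg _) (fun _ => norm_nonneg _)
      simpa only [Function.comp_def, ← sq] using
        this.comp_injective (i := fun p : ι => (p, p)) fun p q h => (Prod.ext_iff.mp h).1
    rw [← ofReal_integral_eq_lintegral_ofReal, h,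
      ENNReal.ofReal_tsum_of_nonneg (fun _ => by positivity) hy2]
    · refine Integrable.of_bound (C := (∑' p, ‖A p y‖) ^ 2) ?_ ?_
      · exact (hm.comp measurable_prodMk_right).aestronglyMeasurable
      · filter_upwards with x
        rw [norm_pow, norm_norm]
        gcongr
        exact norm_tsum_mul_unimodular_le hχ1 hy x
    · exact Filter.Eventually.of_forall fun x => by positivity
  rw [lintegral_congr_ae hinner, lintegral_tsum fun p =>
    ((hAm p).norm.pow_const 2).ennreal_ofReal.aemeasurable]
  have houter : ∀ p, ∫⁻ y, ENNReal.ofReal (‖A p y‖ ^ 2) ∂P =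
      ENNReal.ofReal (∫ y, ‖A p y‖ ^ 2 ∂P) := fun p =>
    (ofReal_integral_eq_lintegral_ofReal (hA2 p)
      (Filter.Eventually.of_forall fun y => by positivity)).symm
  simp_rw [houter]
  rw [← ENNReal.ofReal_tsum_of_nonneg (fun p => integral_nonneg fun y => by positivity) hA2s]
  exact ENNReal.ofReal_lt_top

theorem integrable_and_hasSum_integral_mul_conj [Countable ι] [DecidableEq ι]
    [IsProbabilityMeasure ν] [SFinite P]
    (hχm : ∀ p, Measurable (χ p)) (hχ1 : ∀ p x, ‖χ p x‖ = 1)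
    (hort : ∀ p q, ∫ x, χ p x * conj (χ q x) ∂ν = if p = q then 1 else 0)
    (hAm : ∀ p, Measurable (A p)) (hA : ∀ᵐ y ∂P, Summable fun p => ‖A p y‖)
    (hA2 : ∀ p, Integrable (fun y => ‖A p y‖ ^ 2) P)
    (hA2s : Summable fun p => ∫ y, ‖A p y‖ ^ 2 ∂P)
    (hBm : ∀ p, Measurable (B p)) (hB : ∀ᵐ y ∂P, Summable fun p => ‖B p y‖)
    (hB2 : ∀ p, Integrable (fun y => ‖B p y‖ ^ 2) P)
    (hB2s : Summable fun p => ∫ y, ‖B p y‖ ^ 2 ∂P) :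
    Integrable (fun z : X × Y => (∑' p, A p z.2 * χ p z.1) * conj (∑' p, B p z.2 * χ p z.1))
        (ν.prod P) ∧
      HasSum (fun p => ∫ y, A p y * conj (B p y) ∂P)
        (∫ z, (∑' p, A p z.2 * χ p z.1) * conj (∑' p, B p z.2 * χ p z.1) ∂(ν.prod P)) := by
  have hmeas : ∀ {A : ι → Y → ℂ}, (∀ p, Measurable (A p)) →
      Measurable fun z : X × Y => ∑' p, A p z.2 * χ p z.1 := fun h =>
    Measurable.tsum fun p => ((h p).comp measurable_snd).mul ((hχm p).comp measurable_fst)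
  have hprod : ∀ s t : ℝ, s * t ≤ s ^ 2 + t ^ 2 := fun s t => by
    nlinarith [sq_nonneg (s - t), sq_nonneg (s + t)]
  have hint : Integrable (fun z : X × Y =>
      (∑' p, A p z.2 * χ p z.1) * conj (∑' p, B p z.2 * χ p z.1)) (ν.prod P) := by
    refine ((integrable_norm_sq_tsum hχm hχ1 hort hAm hA hA2 hA2s).add
      (integrable_norm_sq_tsum hχm hχ1 hort hBm hB hB2 hB2s)).mono' ?_ ?_
    · exact ((hmeas hAm).mul
        (Complex.continuous_conj.measurable.comp (hmeas hBm))).aestronglyMeasurable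
    · filter_upwards with z
      rw [norm_mul, RCLike.norm_conj]
      exact hprod _ _
  have hnorm : ∀ p y, ‖A p y * conj (B p y)‖ ≤ ‖A p y‖ ^ 2 + ‖B p y‖ ^ 2 := fun p y => by
    rw [norm_mul, RCLike.norm_conj]
    exact hprod _ _
  have hABi : ∀ p, Integrable (fun y => A p y * conj (B p y)) P := fun p =>
    ((hA2 p).add (hB2 p)).mono' ((hAm p).mul
      (Complex.continuous_conj.measurable.comp (hBm p))).aestronglyMeasurable
      (Filter.Eventually.of_forall (hnorm p))
  refine ⟨hint, ?_⟩
  rw [integral_prod_symm _ hint]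
  have hinner : ∀ᵐ y ∂P, ∫ x, (∑' p, A p y * χ p x) * conj (∑' p, B p y * χ p x) ∂ν =
      ∑' p, A p y * conj (B p y) := by
    filter_upwards [hA, hB] with y hy hy' using integral_tsum_mul_conj_tsum hχm hχ1 hort hy hy'
  rw [integral_congr_ae hinner]
  refine hasSum_integral_of_summable_integral_norm hABi
    ((hA2s.add hB2s).of_nonneg_of_le (fun p => integral_nonneg fun y => norm_nonneg _) fun p => ?_)
  rw [← integral_add (hA2 p) (hB2 p)]
  exact integral_mono (hABi p).norm ((hA2 p).add (hB2 p)) (hnorm p)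

end Orthonormal

theorem norm_e (w : ℂ) : ‖e w‖ = Real.exp (-2 * Real.pi * w.im) := by
  rw [e, Complex.norm_exp]
  congr 1
  simp

theorem e_add (w z : ℂ) : e (w + z) = e w * e z := by
  rw [e, e, e, ← Complex.exp_add, mul_add]

theorem continuous_e : Continuous e := by
  unfold e
  fun_prop

section GaussGamma

variable {κ lam α : ℝ}

theorem integral_gaussian_shift_div (t : ℝ) {v : ℝ} (hv : 0 < v) :
    ∫ y, Real.exp (-κ * (y + t * v) ^ 2 / v) = √(Real.pi / κ) * v ^ (1 / 2 : ℝ) := by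
  have h : ∀ y, Real.exp (-κ * (y + t * v) ^ 2 / v) =
      (fun y => Real.exp (-(κ / v) * y ^ 2)) (y + t * v) := fun y => by
    simp only
    congr 1
    ring
  simp_rw [h]
  rw [integral_add_right_eq_self (fun y => Real.exp (-(κ / v) * y ^ 2)), integral_gaussian,
    ← Real.sqrt_eq_rpow, ← Real.sqrt_mul' _ hv.le]
  congr 1
  field_simp

theorem integrable_gaussian_shift_div (hκ : 0 < κ) (t : ℝ) {v : ℝ} (hv : 0 < v) :
    Integrable fun y => Real.exp (-κ * (y + t * v) ^ 2 / v) := by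
  have := (integrable_exp_neg_mul_sq (b := κ / v) (by positivity)).comp_add_right (t * v)
  refine this.congr (Filter.Eventually.of_forall fun y => ?_)
  simp only
  congr 1
  ring

theorem integrable_gaussian_gamma (hκ : 0 < κ) (hlam : 0 < lam) (hα : -(3 / 2) < α) (t : ℝ) :
    Integrable (fun p : ℝ × ℝ => p.1 ^ α * Real.exp (-κ * (p.2 + t * p.1) ^ 2 / p.1) *
      Real.exp (-lam * p.1)) ((volume.restrict (Ioi 0)).prod volume) := by
  have hm : Measurable (fun p : ℝ × ℝ => p.1 ^ α * Real.exp (-κ * (p.2 + t * p.1) ^ 2 / p.1) *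
      Real.exp (-lam * p.1)) := by fun_prop
  rw [integrable_prod_iff hm.aestronglyMeasurable]
  constructor
  · filter_upwards [self_mem_ae_restrict measurableSet_Ioi] with v hv
    exact ((integrable_gaussian_shift_div hκ t hv).const_mul _).mul_const _
  · have h := (integrableOn_rpow_mul_exp_neg_mul_rpow (p := 1) (s := α + 1 / 2) (b := lam)
      (by linarith) one_pos hlam).const_mul √(Real.pi / κ)
    refine Integrable.congr h ?_
    filter_upwards [self_mem_ae_restrict measurableSet_Ioi] with v hv
    have hv' : (0 : ℝ) < v := hv
    have hn : ∀ y, ‖v ^ α * Real.exp (-κ * (y + t * v) ^ 2 / v) * Real.exp (-lam * v)‖ =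
        v ^ α * Real.exp (-κ * (y + t * v) ^ 2 / v) * Real.exp (-lam * v) := fun y =>
      Real.norm_of_nonneg (by positivity)
    simp_rw [hn]
    rw [integral_mul_const, integral_const_mul, integral_gaussian_shift_div t hv,
      Real.rpow_add hv', Real.rpow_one]
    ring

theorem integral_gaussian_gamma (hκ : 0 < κ) (hlam : 0 < lam) (hα : -(3 / 2) < α) (t : ℝ) :
    ∫ p : ℝ × ℝ, p.1 ^ α * Real.exp (-κ * (p.2 + t * p.1) ^ 2 / p.1) *
      Real.exp (-lam * p.1) ∂((volume.restrict (Ioi 0)).prod volume) =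
      √(Real.pi / κ) * ((1 / lam) ^ (α + 3 / 2) * Real.Gamma (α + 3 / 2)) := by
  rw [integral_prod _ (integrable_gaussian_gamma hκ hlam hα t),
    ← Real.integral_rpow_mul_exp_neg_mul_Ioi (by linarith) hlam, ← integral_const_mul]
  refine setIntegral_congr_fun measurableSet_Ioi fun v hv => ?_
  have hv' : (0 : ℝ) < v := hv
  simp only
  rw [integral_mul_const, integral_const_mul, integral_gaussian_shift_div t hv,
    show α + 3 / 2 - 1 = α + 1 / 2 by ring, Real.rpow_add hv', neg_mul]
  ring

end GaussGamma

theorem summable_of_le_discriminant {m : ℕ} (hm : 1 ≤ m) {f : ℕ × ℤ → ℝ} (hf : ∀ p, 0 ≤ f p)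
    {g : ℕ → ℝ} {h : ℤ → ℝ} (hg : Summable g) (hh : Summable h) (hg0 : ∀ d, 0 ≤ g d)
    (hh0 : ∀ r, 0 ≤ h r) (hz : ∀ (n : ℕ) (r : ℤ), 4 * (n : ℤ) * m - r ^ 2 ≤ 0 → f (n, r) = 0)
    (hle : ∀ (n : ℕ) (r : ℤ) (d : ℕ), 4 * (n : ℤ) * m - r ^ 2 = d → 0 < d →
      f (n, r) ≤ g d * h r) : Summable f := by
  set S : Set (ℕ × ℤ) := {p | 0 < 4 * (p.1 : ℤ) * m - p.2 ^ 2} with hS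
  have hgh : Summable fun q : ℕ × ℤ => g q.1 * h q.2 := hg.mul_of_nonneg hh hg0 hh0
  have hinj : Function.Injective
      fun p : S => (((4 * (p.1.1 : ℤ) * m - p.1.2 ^ 2).toNat, p.1.2) : ℕ × ℤ) := by
    rintro ⟨⟨n, r⟩, hp⟩ ⟨⟨n', r'⟩, hp'⟩ heq
    simp only [Prod.mk.injEq, hS, mem_ofPred_eq] at heq hp hp'
    obtain ⟨h1, rfl⟩ := heq
    have h2 : (n : ℤ) * m = n' * m := by
      have h3 := Int.toNat_of_nonneg hp.le
      have h4 := Int.toNat_of_nonneg hp'.le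
      rw [h1, h4] at h3
      linarith
    have h5 : n = n' := by
      have : (m : ℤ) ≠ 0 := by omega
      exact_mod_cast mul_right_cancel₀ this h2
    simp [h5]
  have hsub : Summable fun p : S => f p.1 := by
    refine Summable.of_nonneg_of_le (fun p => hf _) ?_ (hgh.comp_injective hinj)
    rintro ⟨⟨n, r⟩, hp⟩
    have hp' : 0 < 4 * (n : ℤ) * m - r ^ 2 := hp
    exact hle n r _ (Int.toNat_of_nonneg hp'.le).symm (Int.pos_iff_toNat_pos.mp hp')
  have hind : f = S.indicator f := by
    ext ⟨n, r⟩
    by_cases hp : 0 < 4 * (n : ℤ) * m - r ^ 2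
    · rw [indicator_of_mem (show (n, r) ∈ S from hp)]
    · rw [indicator_of_notMem (show (n, r) ∉ S from hp)]
      exact hz n r (not_lt.mp hp)
  rw [hind]
  exact summable_subtype_iff_indicator.mp hsub

theorem four_mul_mul_eq_of_discriminant {m n d : ℕ} {r : ℤ} (hd : 4 * (n : ℤ) * m - r ^ 2 = d) :
    4 * (n : ℝ) * m - (r : ℝ) ^ 2 = d := by
  exact_mod_cast hd

theorem summable_norm_fourier {m : ℕ} (hm : 1 ≤ m) {c : ℕ → ℤ → ℂ} {C s : ℝ}
    (hvan : ∀ (n : ℕ) (r : ℤ), 4 * (n : ℤ) * m - r ^ 2 ≤ 0 → c n r = 0)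
    (hgrow : ∀ (n : ℕ) (r : ℤ), 0 < 4 * (n : ℤ) * m - r ^ 2 →
      ‖c n r‖ ≤ C * (4 * (n : ℝ) * m - (r : ℝ) ^ 2) ^ s)
    {v : ℝ} (hv : 0 < v) (y : ℝ) :
    Summable fun p : ℕ × ℤ => ‖c p.1 p.2‖ * Real.exp (-2 * Real.pi * (p.1 * v + p.2 * y)) := by
  have hm0 : (0 : ℝ) < m := by exact_mod_cast hm
  have hpi := Real.pi_pos
  obtain ⟨N, hN⟩ := exists_nat_ge s
  have hg : Summable fun d : ℕ =>
      |C| * ((d : ℝ) ^ N * Real.exp (-(Real.pi * v / (2 * m)) * d)) :=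
    (Real.summable_pow_mul_exp_neg_nat_mul N (by positivity)).mul_left _
  have hh : Summable fun r : ℤ =>
      Real.exp (-Real.pi * r ^ 2 * (v / (2 * m)) - 2 * Real.pi * r * y) := by
    have := (summable_jacobiTheta₂_term_iff ⟨0, y⟩ ⟨0, v / (2 * m)⟩).mpr
      (show 0 < v / (2 * m) by positivity)
    simpa only [norm_jacobiTheta₂_term] using this.norm
  refine summable_of_le_discriminant hm (fun p => by positivity) hg hh (fun d => by positivity)
    (fun r => by positivity) (fun n r h => by simp [hvan n r h]) fun n r d hd hd0 => ?_
  have hd' := four_mul_mul_eq_of_discriminant hd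
  have hd1 : (1 : ℝ) ≤ d := by exact_mod_cast hd0
  have hc := hgrow n r (by omega)
  rw [hd'] at hc
  have hpow : (d : ℝ) ^ s ≤ (d : ℝ) ^ N := by
    rw [← Real.rpow_natCast]
    exact Real.rpow_le_rpow_of_exponent_le hd1 hN
  have hc' : ‖c n r‖ ≤ |C| * (d : ℝ) ^ N := hc.trans (by gcongr; exact le_abs_self C)
  have hexp : Real.exp (-2 * Real.pi * (n * v + r * y)) =
      Real.exp (-(Real.pi * v / (2 * m)) * d) *
        Real.exp (-Real.pi * r ^ 2 * (v / (2 * m)) - 2 * Real.pi * r * y) := by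
    rw [← Real.exp_add, ← hd']
    congr 1
    field_simp
    ring
  calc ‖c n r‖ * Real.exp (-2 * Real.pi * (n * v + r * y))
      ≤ (|C| * (d : ℝ) ^ N) * Real.exp (-2 * Real.pi * (n * v + r * y)) := by gcongr
    _ = _ := by rw [hexp]; ring

theorem sigma1_le_rpow (n : ℕ) : (sigma1 n : ℝ) ≤ 17 * (n : ℝ) ^ (17 / 16 : ℝ) := by
  rcases Nat.eq_zero_or_pos n with rfl | hn
  · simp [sigma1, Real.zero_rpow]
  have hn0 : (0 : ℝ) < n := by exact_mod_cast hn
  have hn1 : (1 : ℝ) ≤ n := by exact_mod_cast hn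
  have h1 : (sigma1 n : ℝ) = ∑ d ∈ n.divisors, (n : ℝ) * (d : ℝ)⁻¹ := by
    rw [sigma1, ← Nat.sum_div_divisors]
    push_cast
    refine Finset.sum_congr rfl fun d hd => ?_
    rw [Nat.cast_div (Nat.dvd_of_mem_divisors hd)
      (by exact_mod_cast (Nat.pos_of_mem_divisors hd).ne'), div_eq_mul_inv]
  have h2 : ∑ d ∈ n.divisors, (d : ℝ)⁻¹ ≤ 1 + Real.log n := by
    refine le_trans ?_ (harmonic_le_one_add_log n)
    rw [harmonic_eq_sum_Icc]
    push_cast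
    exact Finset.sum_le_sum_of_subset_of_nonneg
      (fun d hd => Finset.mem_Icc.mpr ⟨Nat.pos_of_mem_divisors hd, Nat.divisor_le hd⟩)
      fun d _ _ => by positivity
  have h3 := Real.log_le_rpow_div hn0.le (show (0 : ℝ) < 1 / 16 by norm_num)
  have h4 : (1 : ℝ) ≤ (n : ℝ) ^ (1 / 16 : ℝ) := Real.one_le_rpow hn1 (by norm_num)
  have h5 : (n : ℝ) ^ (17 / 16 : ℝ) = n * (n : ℝ) ^ (1 / 16 : ℝ) := by
    rw [show (17 / 16 : ℝ) = 1 + 1 / 16 by norm_num, Real.rpow_add hn0, Real.rpow_one]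
  rw [h1, ← Finset.mul_sum, h5]
  calc (n : ℝ) * ∑ d ∈ n.divisors, (d : ℝ)⁻¹ ≤ n * (17 * (n : ℝ) ^ (1 / 16 : ℝ)) := by
        gcongr
        linarith
    _ = _ := by ring

section Torus

/-- The uniform measure on the square `[0,1]²` of real parts `(u, x)`. -/
def squareMeasure : Measure (ℝ × ℝ) :=
  (volume.restrict (Icc 0 1)).prod (volume.restrict (Icc 0 1))

/-- The measure on the domain `v > 0`, `y ∈ ℝ` of imaginary parts `(v, y)`. -/
def imMeasure : Measure (ℝ × ℝ) := (volume.restrict (Ioi 0)).prod volume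

instance : SFinite imMeasure := by
  unfold imMeasure
  infer_instance

instance : IsProbabilityMeasure squareMeasure := by
  have : IsProbabilityMeasure ((volume : Measure ℝ).restrict (Icc 0 1)) := ⟨by simp⟩
  unfold squareMeasure
  infer_instance

theorem ae_imMeasure_pos : ∀ᵐ y ∂imMeasure, 0 < y.1 := by
  have h : ∀ᵐ v ∂(volume : Measure ℝ).restrict (Ioi 0), 0 < v :=
    self_mem_ae_restrict measurableSet_Ioi
  exact Measure.quasiMeasurePreserving_fst.ae h

/-- The character `(u, x) ↦ e^{2πi(nu + rx)}` attached to `p = (n, r)`. -/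
def squareChar (p : ℕ × ℤ) (x : ℝ × ℝ) : ℂ := e ((p.1 : ℂ) * x.1 + (p.2 : ℂ) * x.2)

theorem measurable_squareChar (p : ℕ × ℤ) : Measurable (squareChar p) :=
  continuous_e.measurable.comp (by fun_prop)

theorem norm_squareChar (p : ℕ × ℤ) (x : ℝ × ℝ) : ‖squareChar p x‖ = 1 := by
  rw [squareChar, norm_e]
  simp

theorem conj_e_ofReal (x : ℝ) : conj (e x) = e (-x) := by
  rw [e, e, ← Complex.exp_conj]
  congr 1
  simp [Complex.conj_ofNat]

theorem integral_e_int_mul (j : ℤ) :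
    ∫ u in Icc (0 : ℝ) 1, e ((j : ℂ) * u) = if j = 0 then 1 else 0 := by
  rw [integral_Icc_eq_integral_Ioc, ← intervalIntegral.integral_of_le zero_le_one]
  split_ifs with hj
  · simp [hj, e]
  · have hne : 2 * (Real.pi : ℂ) * Complex.I * j ≠ 0 := by
      simp [Real.pi_ne_zero, hj]
    simp_rw [e, ← mul_assoc]
    rw [integral_exp_mul_complex hne]
    have : 2 * (Real.pi : ℂ) * Complex.I * j * (1 : ℝ) = j * (2 * Real.pi * Complex.I) := by
      push_cast
      ring
    rw [this, Complex.exp_int_mul_two_pi_mul_I]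
    simp

theorem integral_squareChar_mul_conj (p q : ℕ × ℤ) :
    ∫ x, squareChar p x * conj (squareChar q x) ∂squareMeasure = if p = q then 1 else 0 := by
  have h : ∀ x : ℝ × ℝ, squareChar p x * conj (squareChar q x) =
      e ((((p.1 : ℤ) - q.1 : ℤ) : ℂ) * x.1) * e (((p.2 - q.2 : ℤ) : ℂ) * x.2) := fun x => by
    have h2 : (q.1 : ℂ) * x.1 + (q.2 : ℂ) * x.2 = ((q.1 * x.1 + q.2 * x.2 : ℝ) : ℂ) := by
      push_cast
      rfl
    rw [squareChar, squareChar, h2, conj_e_ofReal, ← e_add, ← e_add]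
    congr 1
    push_cast
    ring
  simp_rw [h, squareMeasure]
  rw [integral_prod_mul (fun u : ℝ => e ((((p.1 : ℤ) - q.1 : ℤ) : ℂ) * u))
    (fun x : ℝ => e (((p.2 - q.2 : ℤ) : ℂ) * x)), integral_e_int_mul, integral_e_int_mul]
  simp only [sub_eq_zero, Nat.cast_inj, Prod.ext_iff]
  split_ifs <;> simp_all

theorem measurePreserving_middle_swap {α β γ δ : Type*} [MeasurableSpace α] [MeasurableSpace β]
    [MeasurableSpace γ] [MeasurableSpace δ] (a : Measure α) (b : Measure β) (c : Measure γ)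
    (d : Measure δ) [SFinite a] [SFinite b] [SFinite c] [SFinite d] :
    MeasurePreserving (fun p : α × β × γ × δ => ((p.1, p.2.2.1), (p.2.1, p.2.2.2)))
      (a.prod (b.prod (c.prod d))) ((a.prod c).prod (b.prod d)) := by
  have h1 : MeasurePreserving MeasurableEquiv.prodAssoc ((b.prod c).prod d)
    (b.prod (c.prod d)) := ⟨MeasurableEquiv.measurable _, Measure.prodAssoc_prod⟩
  have h2 : MeasurePreserving MeasurableEquiv.prodAssoc ((c.prod b).prod d)
    (c.prod (b.prod d)) := ⟨MeasurableEquiv.measurable _, Measure.prodAssoc_prod⟩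
  have h3 : MeasurePreserving MeasurableEquiv.prodAssoc ((a.prod c).prod (b.prod d))
    (a.prod (c.prod (b.prod d))) := ⟨MeasurableEquiv.measurable _, Measure.prodAssoc_prod⟩
  have h4 : MeasurePreserving Prod.swap (b.prod c) (c.prod b) := Measure.measurePreserving_swap
  have h5 := (h2.comp (h4.prod (MeasurePreserving.id d))).comp (h1.symm _)
  exact (h3.symm _).comp ((MeasurePreserving.id a).prod h5)

theorem measurePreserving_region :
    MeasurePreserving (fun p : ℝ × ℝ × ℝ × ℝ => ((p.1, p.2.2.1), (p.2.1, p.2.2.2)))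
      (volume.restrict Reg) (squareMeasure.prod imMeasure) := by
  have h : (volume : Measure (ℝ × ℝ × ℝ × ℝ)).restrict Reg =
      (volume.restrict (Icc 0 1)).prod ((volume.restrict (Ioi 0)).prod
        ((volume.restrict (Icc 0 1)).prod volume)) := by
    rw [Reg, Measure.volume_eq_prod, Measure.volume_eq_prod, Measure.volume_eq_prod,
      ← Measure.prod_restrict, ← Measure.prod_restrict, ← Measure.prod_restrict,
      Measure.restrict_univ]
  rw [h]
  exact measurePreserving_middle_swap _ _ _ _

end Torus

section WeightedCoefficients

/-- The weight `v^{α/2} e^{-2πmy²/v + sπm(y+tv)²/v}`. -/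
def gaussWeight (m : ℕ) (s t α : ℝ) (y : ℝ × ℝ) : ℝ :=
  y.1 ^ (α / 2) * Real.exp (-2 * Real.pi * m * y.2 ^ 2 / y.1 +
    s * Real.pi * m * (y.2 + t * y.1) ^ 2 / y.1)

/-- The Fourier coefficient in `(u, x)` of `φ` multiplied by `gaussWeight`. -/
def weightedCoeff (m : ℕ) (s t α : ℝ) (c : ℕ → ℤ → ℂ) (p : ℕ × ℤ) (y : ℝ × ℝ) : ℂ :=
  c p.1 p.2 * ((Real.exp (-2 * Real.pi * (p.1 * y.1 + p.2 * y.2)) * gaussWeight m s t α y : ℝ) : ℂ)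

variable {m : ℕ} {s t α : ℝ} {c : ℕ → ℤ → ℂ}

theorem measurable_weightedCoeff (p : ℕ × ℤ) : Measurable (weightedCoeff m s t α c p) := by
  unfold weightedCoeff gaussWeight
  fun_prop

theorem phiF_mul_gaussWeight (u x v y : ℝ) :
    phiF c ⟨u, v⟩ ⟨x, y⟩ * gaussWeight m s t α (v, y) =
      ∑' p, weightedCoeff m s t α c p (v, y) * squareChar p (u, x) := by
  rw [phiF, ← tsum_mul_right]
  refine tsum_congr fun p => ?_
  have h1 : (p.1 : ℂ) * ⟨u, v⟩ + (p.2 : ℂ) * ⟨x, y⟩ =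
      ((p.1 : ℂ) * u + (p.2 : ℂ) * x) + ((p.1 * v + p.2 * y : ℝ) : ℂ) * Complex.I := by
    apply Complex.ext <;> simp
  have h2 : e (((p.1 * v + p.2 * y : ℝ) : ℂ) * Complex.I) =
      (Real.exp (-2 * Real.pi * (p.1 * v + p.2 * y)) : ℝ) := by
    rw [e, Complex.ofReal_exp]
    congr 1
    push_cast
    linear_combination (2 * (Real.pi : ℂ) * (p.1 * v + p.2 * y)) * Complex.I_mul_I
  rw [h1, e_add, h2, weightedCoeff, squareChar]
  push_cast
  ring

theorem summable_norm_weightedCoeff (hm : 1 ≤ m) {C σ : ℝ}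
    (hvan : ∀ (n : ℕ) (r : ℤ), 4 * (n : ℤ) * m - r ^ 2 ≤ 0 → c n r = 0)
    (hgrow : ∀ (n : ℕ) (r : ℤ), 0 < 4 * (n : ℤ) * m - r ^ 2 →
      ‖c n r‖ ≤ C * (4 * (n : ℝ) * m - (r : ℝ) ^ 2) ^ σ) {y : ℝ × ℝ} (hy : 0 < y.1) :
    Summable fun p => ‖weightedCoeff m s t α c p y‖ := by
  refine ((summable_norm_fourier hm hvan hgrow hy y.2).mul_right
    ‖gaussWeight m s t α y‖).congr fun p => ?_
  rw [weightedCoeff, norm_mul, Complex.norm_real, norm_mul, Real.norm_of_nonneg (Real.exp_nonneg _),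
    mul_assoc]

theorem norm_weightedCoeff_sq (hm : 1 ≤ m) (p : ℕ × ℤ) {y : ℝ × ℝ} (hy : 0 < y.1) :
    ‖weightedCoeff m s t α c p y‖ ^ 2 = ‖c p.1 p.2‖ ^ 2 * (y.1 ^ α *
      Real.exp (-4 * Real.pi * m * (y.2 + p.2 / (2 * m) * y.1) ^ 2 / y.1 +
        2 * s * Real.pi * m * (y.2 + t * y.1) ^ 2 / y.1 -
        Real.pi / m * (4 * (p.1 : ℝ) * m - (p.2 : ℝ) ^ 2) * y.1)) := by
  have hm0 : (0 : ℝ) < m := by exact_mod_cast hm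
  rw [weightedCoeff, norm_mul, mul_pow, Complex.norm_real, Real.norm_eq_abs, sq_abs, gaussWeight,
    mul_pow, mul_pow, ← Real.exp_nat_mul, ← Real.exp_nat_mul, ← Real.rpow_mul_natCast hy.le,
    mul_left_comm (Real.exp _) (y.1 ^ _), ← Real.exp_add]
  congr 3
  · push_cast; ring
  · push_cast
    field_simp
    ring

theorem integrable_of_le_gaussian_gamma {κ lam K T : ℝ} (hκ : 0 < κ) (hlam : 0 < lam)
    (hα : -(3 / 2) < α) {f : ℝ × ℝ → ℝ} (hfm : Measurable f) (hf : ∀ y, 0 ≤ f y)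
    (hle : ∀ y : ℝ × ℝ, 0 < y.1 → f y ≤ K * (y.1 ^ α *
      Real.exp (-κ * (y.2 + T * y.1) ^ 2 / y.1) * Real.exp (-lam * y.1))) :
    Integrable f imMeasure ∧
      ∫ y, f y ∂imMeasure ≤
        K * (√(Real.pi / κ) * ((1 / lam) ^ (α + 3 / 2) * Real.Gamma (α + 3 / 2))) := by
  have hG := (integrable_gaussian_gamma hκ hlam hα T).const_mul K
  have hae : ∀ᵐ y ∂imMeasure, f y ≤ K * (y.1 ^ α *
      Real.exp (-κ * (y.2 + T * y.1) ^ 2 / y.1) * Real.exp (-lam * y.1)) := by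
    filter_upwards [ae_imMeasure_pos] with y hy using hle y hy
  have hint : Integrable f imMeasure := by
    refine hG.mono' hfm.aestronglyMeasurable ?_
    filter_upwards [hae] with y hy
    rwa [Real.norm_of_nonneg (hf y)]
  refine ⟨hint, ?_⟩
  rw [← integral_gaussian_gamma hκ hlam hα T, ← integral_const_mul]
  exact integral_mono_ae hint hG hae

theorem summable_inv_one_add_sq_rpow (w : ℤ) :
    Summable fun r : ℤ => (1 + ((r : ℝ) - w) ^ 2) ^ (-(5 / 8) : ℝ) := by
  have h := (Real.summable_one_div_int_add_rpow (-w) (5 / 4)).mpr (by norm_num)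
  refine h.of_norm_bounded_eventually ?_
  have : ∀ᶠ r : ℤ in Filter.cofinite, r ≠ w := (Set.finite_singleton w).compl_mem_cofinite
  filter_upwards [this] with r hr
  have h0 : 0 < |(r : ℝ) + -w| := by
    rw [abs_pos]
    intro h
    exact hr (by exact_mod_cast (by linarith : (r : ℝ) = w))
  rw [Real.norm_of_nonneg (by positivity), one_div, ← Real.rpow_neg h0.le,
    show (-(5 / 4) : ℝ) = 2 * (-(5 / 8)) by norm_num, Real.rpow_mul h0.le, Real.rpow_two, sq_abs,
    ← sub_eq_add_neg]
  exact Real.rpow_le_rpow_of_nonpos (by rw [sub_eq_add_neg, ← sq_abs]; positivity) (by linarith)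
    (by norm_num)

theorem summable_nat_rpow_neg_nine_eighths :
    Summable fun d : ℕ => (d : ℝ) ^ (-(9 / 8) : ℝ) :=
  Real.summable_nat_rpow.mpr (by norm_num)

end WeightedCoefficients

section SquareIntegrable

variable {m : ℕ} {c : ℕ → ℤ → ℂ} {C : ℝ}

theorem integrable_weightedCoeff_sq_and_summable (hm : 1 ≤ m) {s t α : ℝ}
    {g : ℕ → ℝ} {h : ℤ → ℝ} (hg : Summable g) (hh : Summable h) (hg0 : ∀ d, 0 ≤ g d)
    (hh0 : ∀ r, 0 ≤ h r)
    (hvan : ∀ (n : ℕ) (r : ℤ), 4 * (n : ℤ) * m - r ^ 2 ≤ 0 → c n r = 0)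
    (hbd : ∀ (n : ℕ) (r : ℤ) (d : ℕ), 4 * (n : ℤ) * m - r ^ 2 = d → 0 < d →
      Integrable (fun y => ‖weightedCoeff m s t α c (n, r) y‖ ^ 2) imMeasure ∧
        ∫ y, ‖weightedCoeff m s t α c (n, r) y‖ ^ 2 ∂imMeasure ≤ g d * h r) :
    (∀ p, Integrable (fun y => ‖weightedCoeff m s t α c p y‖ ^ 2) imMeasure) ∧
      Summable fun p => ∫ y, ‖weightedCoeff m s t α c p y‖ ^ 2 ∂imMeasure := by
  have hzero : ∀ (n : ℕ) (r : ℤ), 4 * (n : ℤ) * m - r ^ 2 ≤ 0 → ∀ y,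
      ‖weightedCoeff m s t α c (n, r) y‖ ^ 2 = 0 := fun n r hp y => by
    simp [weightedCoeff, hvan n r hp]
  refine ⟨fun ⟨n, r⟩ => ?_, summable_of_le_discriminant hm
    (fun p => integral_nonneg fun y => by positivity) hg hh hg0 hh0 (fun n r hp => ?_)
    fun n r d hd hd0 => (hbd n r d hd hd0).2⟩
  · rcases le_or_gt (4 * (n : ℤ) * m - r ^ 2) 0 with hp | hp
    · simp_rw [hzero n r hp]
      exact integrable_zero _ _ _
    · exact (hbd n r _ (Int.toNat_of_nonneg hp.le).symm (Int.pos_iff_toNat_pos.mp hp)).1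
  · simp_rw [hzero n r hp]
    simp

theorem square_integrable_weightedCoeff_cusp {k : ℕ} (hm : 1 ≤ m) (w : ℤ)
    (hvan : ∀ (n : ℕ) (r : ℤ), 4 * (n : ℤ) * m - r ^ 2 ≤ 0 → c n r = 0)
    (hgrow : ∀ (n : ℕ) (r : ℤ), 0 < 4 * (n : ℤ) * m - r ^ 2 →
      ‖c n r‖ ≤ C * (4 * (n : ℝ) * m - (r : ℝ) ^ 2) ^ (((k : ℝ) + 1) / 2)) :
    (∀ p, Integrable (fun y =>
      ‖weightedCoeff m (-1) (w / (2 * m)) (k + 5 / 4) c p y‖ ^ 2) imMeasure) ∧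
      Summable fun p =>
        ∫ y, ‖weightedCoeff m (-1) (w / (2 * m)) (k + 5 / 4) c p y‖ ^ 2 ∂imMeasure := by
  have hm0 : (0 : ℝ) < m := by exact_mod_cast hm
  have hpi := Real.pi_pos
  have hk0 : (0 : ℝ) ≤ k := k.cast_nonneg
  have hΓ : 0 < Real.Gamma (k + 5 / 4 + 3 / 2) := Real.Gamma_pos_of_pos (by positivity)
  set M : ℝ := C ^ 2 * (√(Real.pi / (2 * Real.pi * m)) *
    ((4 * m / Real.pi) ^ ((k : ℝ) + 5 / 4 + 3 / 2) * Real.Gamma (k + 5 / 4 + 3 / 2))) with hM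
  have hM0 : 0 ≤ M := by positivity
  refine integrable_weightedCoeff_sq_and_summable hm
    (summable_nat_rpow_neg_nine_eighths.mul_left M) (summable_inv_one_add_sq_rpow w)
    (fun d => by positivity) (fun r => by positivity) hvan fun n r d hd hd0 => ?_
  have hd' := four_mul_mul_eq_of_discriminant hd
  have hd1 : (1 : ℝ) ≤ d := by exact_mod_cast hd0
  have hdpos : (0 : ℝ) < d := by linarith
  have hsq : 0 ≤ ((r : ℝ) - w) ^ 2 := sq_nonneg _
  set x : ℝ := d + ((r : ℝ) - w) ^ 2 with hx
  have hx0 : 0 < x := by positivity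
  have hc := hgrow n r (by omega)
  rw [hd'] at hc
  have hlam : 0 < Real.pi / (4 * m) * x := by positivity
  obtain ⟨hI, hle⟩ := integrable_of_le_gaussian_gamma (κ := 2 * Real.pi * m)
    (K := ‖c n r‖ ^ 2) (T := r / (2 * m)) (α := k + 5 / 4) (by positivity) hlam (by linarith)
    ((measurable_weightedCoeff (m := m) (s := -1) (t := w / (2 * m)) (α := k + 5 / 4) (c := c)
      (n, r)).norm.pow_const 2) (fun y => by positivity) fun y hy => by
      rw [norm_weightedCoeff_sq hm _ hy, hd', mul_assoc (y.1 ^ _), ← Real.exp_add]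
      gcongr
      rw [← sub_nonneg]
      have : -(2 * Real.pi * m) * (y.2 + r / (2 * m) * y.1) ^ 2 / y.1 +
          -(Real.pi / (4 * m) * x) * y.1 -
          (-4 * Real.pi * m * (y.2 + r / (2 * m) * y.1) ^ 2 / y.1 +
          2 * -1 * Real.pi * m * (y.2 + w / (2 * m) * y.1) ^ 2 / y.1 -
          Real.pi / m * d * y.1) =
          Real.pi * m * ((y.2 + r / (2 * m) * y.1) + (y.2 + w / (2 * m) * y.1)) ^ 2 / y.1 +
            3 * (Real.pi / (4 * m)) * d * y.1 := by
        rw [hx]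
        field_simp
        ring
      rw [this]
      positivity
  refine ⟨hI, hle.trans ?_⟩
  have hc2 : ‖c n r‖ ^ 2 ≤ C ^ 2 * (d : ℝ) ^ ((k : ℝ) + 1) := by
    calc ‖c n r‖ ^ 2 ≤ (C * (d : ℝ) ^ (((k : ℝ) + 1) / 2)) ^ 2 := by gcongr
      _ = _ := by
        rw [mul_pow, ← Real.rpow_mul_natCast hdpos.le]
        congr 2
        push_cast
        ring
  have hinv : (1 / (Real.pi / (4 * m) * x)) ^ ((k : ℝ) + 5 / 4 + 3 / 2) =
      (4 * m / Real.pi) ^ ((k : ℝ) + 5 / 4 + 3 / 2) * x ^ (-((k : ℝ) + 5 / 4 + 3 / 2)) := by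
    rw [Real.rpow_neg hx0.le, ← Real.inv_rpow hx0.le, ← Real.mul_rpow (by positivity)
      (by positivity)]
    congr 1
    field_simp
  have hX : (d : ℝ) ^ ((k : ℝ) + 1) * x ^ (-((k : ℝ) + 5 / 4 + 3 / 2)) ≤
      (d : ℝ) ^ (-(9 / 8) : ℝ) * (1 + ((r : ℝ) - w) ^ 2) ^ (-(5 / 8) : ℝ) := by
    calc (d : ℝ) ^ ((k : ℝ) + 1) * x ^ (-((k : ℝ) + 5 / 4 + 3 / 2))
        ≤ x ^ ((k : ℝ) + 1) * x ^ (-((k : ℝ) + 5 / 4 + 3 / 2)) := by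
          gcongr
          linarith
      _ = x ^ (-(9 / 8) : ℝ) * x ^ (-(5 / 8) : ℝ) := by
          rw [← Real.rpow_add hx0, ← Real.rpow_add hx0]
          congr 1
          ring
      _ ≤ _ := mul_le_mul
          (Real.rpow_le_rpow_of_nonpos hdpos (by linarith) (by norm_num))
          (Real.rpow_le_rpow_of_nonpos (by positivity) (by linarith) (by norm_num))
          (by positivity) (by positivity)
  rw [hinv]
  calc _ ≤ (C ^ 2 * (d : ℝ) ^ ((k : ℝ) + 1)) * (√(Real.pi / (2 * Real.pi * m)) *
        ((4 * m / Real.pi) ^ ((k : ℝ) + 5 / 4 + 3 / 2) * x ^ (-((k : ℝ) + 5 / 4 + 3 / 2)) *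
          Real.Gamma (k + 5 / 4 + 3 / 2))) := by gcongr
    _ = M * ((d : ℝ) ^ ((k : ℝ) + 1) * x ^ (-((k : ℝ) + 5 / 4 + 3 / 2))) := by
        rw [hM]
        ring
    _ ≤ M * ((d : ℝ) ^ (-(9 / 8) : ℝ) * (1 + ((r : ℝ) - w) ^ 2) ^ (-(5 / 8) : ℝ)) := by gcongr
    _ = _ := by ring

theorem square_integrable_weightedCoeff_single {k : ℕ} (hk : 4 < k) (hm : 1 ≤ m) (w : ℤ)
    (hvan : ∀ (n : ℕ) (r : ℤ), 4 * (n : ℤ) * m - r ^ 2 ≤ 0 → c n r = 0)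
    (hgrow : ∀ (n : ℕ) (r : ℤ), 0 < 4 * (n : ℤ) * m - r ^ 2 →
      ‖c n r‖ ≤ C * (4 * (n : ℝ) * m - (r : ℝ) ^ 2) ^ (17 / 16 : ℝ))
    (hsupp : ∀ n r, r ≠ w → c n r = 0) :
    (∀ p, Integrable (fun y =>
      ‖weightedCoeff m 1 (w / (2 * m)) (k - 13 / 4) c p y‖ ^ 2) imMeasure) ∧
      Summable fun p =>
        ∫ y, ‖weightedCoeff m 1 (w / (2 * m)) (k - 13 / 4) c p y‖ ^ 2 ∂imMeasure := by
  have hm0 : (0 : ℝ) < m := by exact_mod_cast hm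
  have hpi := Real.pi_pos
  have hk5 : (5 : ℝ) ≤ k := by exact_mod_cast hk
  have hΓ : 0 < Real.Gamma (k - 13 / 4 + 3 / 2) := Real.Gamma_pos_of_pos (by linarith)
  set M : ℝ := C ^ 2 * (√(Real.pi / (2 * Real.pi * m)) *
    ((m / Real.pi) ^ ((k : ℝ) - 13 / 4 + 3 / 2) * Real.Gamma (k - 13 / 4 + 3 / 2))) with hM
  have hM0 : 0 ≤ M := by positivity
  have hh : Summable fun r : ℤ => if r = w then (1 : ℝ) else 0 :=
    (hasSum_ite_eq w 1).summable
  refine integrable_weightedCoeff_sq_and_summable hm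
    (summable_nat_rpow_neg_nine_eighths.mul_left M) hh
    (fun d => by positivity) (fun r => by split_ifs <;> norm_num) hvan fun n r d hd hd0 => ?_
  by_cases hr : r = w
  swap
  · have hz : ∀ y, ‖weightedCoeff m 1 (w / (2 * m)) (k - 13 / 4) c (n, r) y‖ ^ 2 = 0 :=
      fun y => by simp [weightedCoeff, hsupp n r hr]
    simp_rw [hz]
    simp [hr]
  subst hr
  have hd' := four_mul_mul_eq_of_discriminant hd
  have hd1 : (1 : ℝ) ≤ d := by exact_mod_cast hd0
  have hdpos : (0 : ℝ) < d := by linarith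
  have hc := hgrow n r (by omega)
  rw [hd'] at hc
  have hlam : 0 < Real.pi / m * d := by positivity
  obtain ⟨hI, hle⟩ := integrable_of_le_gaussian_gamma (κ := 2 * Real.pi * m)
    (K := ‖c n r‖ ^ 2) (T := r / (2 * m)) (α := k - 13 / 4) (by positivity) hlam (by linarith)
    ((measurable_weightedCoeff (m := m) (s := 1) (t := r / (2 * m)) (α := k - 13 / 4) (c := c)
      (n, r)).norm.pow_const 2) (fun y => by positivity) fun y hy => by
      rw [norm_weightedCoeff_sq hm _ hy, hd', mul_assoc (y.1 ^ _), ← Real.exp_add]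
      refine le_of_eq ?_
      congr 3
      ring
  refine ⟨hI, hle.trans ?_⟩
  have hc2 : ‖c n r‖ ^ 2 ≤ C ^ 2 * (d : ℝ) ^ (17 / 8 : ℝ) := by
    calc ‖c n r‖ ^ 2 ≤ (C * (d : ℝ) ^ (17 / 16 : ℝ)) ^ 2 := by gcongr
      _ = _ := by
        rw [mul_pow, ← Real.rpow_mul_natCast hdpos.le]
        norm_num
  have hinv : (1 / (Real.pi / m * d)) ^ ((k : ℝ) - 13 / 4 + 3 / 2) =
      (m / Real.pi) ^ ((k : ℝ) - 13 / 4 + 3 / 2) * (d : ℝ) ^ (-((k : ℝ) - 13 / 4 + 3 / 2)) := by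
    rw [Real.rpow_neg hdpos.le, ← Real.inv_rpow hdpos.le, ← Real.mul_rpow (by positivity)
      (by positivity)]
    congr 1
    field_simp
  have hX : (d : ℝ) ^ (17 / 8 : ℝ) * (d : ℝ) ^ (-((k : ℝ) - 13 / 4 + 3 / 2)) ≤
      (d : ℝ) ^ (-(9 / 8) : ℝ) := by
    rw [← Real.rpow_add hdpos]
    exact Real.rpow_le_rpow_of_exponent_le hd1 (by linarith)
  rw [hinv, if_pos rfl, mul_one]
  calc _ ≤ (C ^ 2 * (d : ℝ) ^ (17 / 8 : ℝ)) * (√(Real.pi / (2 * Real.pi * m)) *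
        ((m / Real.pi) ^ ((k : ℝ) - 13 / 4 + 3 / 2) * (d : ℝ) ^ (-((k : ℝ) - 13 / 4 + 3 / 2)) *
          Real.Gamma (k - 13 / 4 + 3 / 2))) := by gcongr
    _ = M * ((d : ℝ) ^ (17 / 8 : ℝ) * (d : ℝ) ^ (-((k : ℝ) - 13 / 4 + 3 / 2))) := by
        rw [hM]
        ring
    _ ≤ _ := by gcongr

end SquareIntegrable

section HeatEisenstein

/-- The Fourier coefficients of `(4ℓm - w²) - (m(2k-1)/6) E₂`. -/
def heatEisCoeff (k m ℓ : ℕ) (w : ℤ) (j : ℕ) : ℝ :=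
  if j = 0 then 4 * (ℓ : ℝ) * m - (w : ℝ) ^ 2 - m * (2 * k - 1) / 6
  else 4 * m * (2 * k - 1) * sigma1 j

/-- The Fourier coefficients of `((4ℓm - w²) - (m(2k-1)/6) E₂) q^ℓ ζ^w`. -/
def heatCoeff (k m ℓ : ℕ) (w : ℤ) (n : ℕ) (r : ℤ) : ℂ :=
  if r = w ∧ ℓ ≤ n then (heatEisCoeff k m ℓ w (n - ℓ) : ℂ) else 0

variable {k m ℓ : ℕ} {w : ℤ}

theorem heatCoeff_add (j : ℕ) : heatCoeff k m ℓ w (ℓ + j) w = heatEisCoeff k m ℓ w j := by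
  simp [heatCoeff]

theorem heatCoeff_of_ne (n : ℕ) (r : ℤ) (hr : r ≠ w) : heatCoeff k m ℓ w n r = 0 := by
  simp [heatCoeff, hr]

theorem heatCoeff_eq_zero_of_notMem_range {p : ℕ × ℤ}
    (hp : p ∉ range fun j : ℕ => ((ℓ + j, w) : ℕ × ℤ)) : heatCoeff k m ℓ w p.1 p.2 = 0 := by
  rw [heatCoeff, if_neg]
  rintro ⟨h1, h2⟩
  exact hp ⟨p.1 - ℓ, Prod.ext (Nat.add_sub_cancel' h2) h1.symm⟩

theorem injective_add_mk (ℓ : ℕ) (w : ℤ) :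
    Function.Injective fun j : ℕ => ((ℓ + j, w) : ℕ × ℤ) := fun a b h => by
  simpa using h

theorem heatCoeff_eq_zero (hw : 0 < 4 * (ℓ : ℤ) * m - w ^ 2) (n : ℕ) (r : ℤ)
    (hn : 4 * (n : ℤ) * m - r ^ 2 ≤ 0) : heatCoeff k m ℓ w n r = 0 := by
  rw [heatCoeff, if_neg]
  rintro ⟨rfl, h2⟩
  have : (ℓ : ℤ) * m ≤ n * m := by gcongr
  linarith

theorem norm_heatCoeff_le (hm : 1 ≤ m) (hw : 0 < 4 * (ℓ : ℤ) * m - w ^ 2) (n : ℕ) (r : ℤ)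
    (hn : 0 < 4 * (n : ℤ) * m - r ^ 2) :
    ‖heatCoeff k m ℓ w n r‖ ≤ (|heatEisCoeff k m ℓ w 0| + |4 * (m : ℝ) * (2 * k - 1)| * 17) *
      (4 * (n : ℝ) * m - (r : ℝ) ^ 2) ^ (17 / 16 : ℝ) := by
  have hm1 : (1 : ℝ) ≤ m := by exact_mod_cast hm
  have hD : (1 : ℝ) ≤ 4 * (n : ℝ) * m - (r : ℝ) ^ 2 := by exact_mod_cast hn
  rw [heatCoeff]
  split_ifs with h
  swap
  · rw [norm_zero]
    positivity
  obtain ⟨rfl, h2⟩ := h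
  obtain ⟨j, rfl⟩ := Nat.exists_eq_add_of_le h2
  rw [Nat.add_sub_cancel_left, Complex.norm_real, Real.norm_eq_abs]
  have h1 := Real.one_le_rpow hD (show (0 : ℝ) ≤ 17 / 16 by norm_num)
  rcases Nat.eq_zero_or_pos j with rfl | hj
  · refine (le_mul_of_one_le_right (abs_nonneg _) h1).trans ?_
    gcongr
    exact le_add_of_nonneg_right (by positivity)
  · have hw' : (1 : ℝ) ≤ 4 * (ℓ : ℝ) * m - (r : ℝ) ^ 2 := by exact_mod_cast hw
    have hjD : (j : ℝ) ≤ 4 * ((ℓ + j : ℕ) : ℝ) * m - (r : ℝ) ^ 2 := by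
      push_cast
      nlinarith [(Nat.cast_nonneg j : (0 : ℝ) ≤ j)]
    rw [heatEisCoeff, if_neg hj.ne', abs_mul, Nat.abs_cast]
    calc _ ≤ |4 * (m : ℝ) * (2 * k - 1)| * (17 * (j : ℝ) ^ (17 / 16 : ℝ)) := by
          gcongr
          exact sigma1_le_rpow j
      _ ≤ |4 * (m : ℝ) * (2 * k - 1)| * (17 *
          (4 * ((ℓ + j : ℕ) : ℝ) * m - (r : ℝ) ^ 2) ^ (17 / 16 : ℝ)) := by gcongr
      _ ≤ _ := by
        rw [← mul_assoc]
        gcongr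
        exact le_add_of_nonneg_left (abs_nonneg _)

theorem summable_heatCoeff (hm : 1 ≤ m) (hw : 0 < 4 * (ℓ : ℤ) * m - w ^ 2) {τ : ℂ}
    (hτ : 0 < τ.im) (z : ℂ) :
    Summable fun p : ℕ × ℤ =>
      heatCoeff k m ℓ w p.1 p.2 * e ((p.1 : ℂ) * τ + (p.2 : ℂ) * z) := by
  refine Summable.of_norm ((summable_norm_fourier hm (heatCoeff_eq_zero (k := k) hw)
    (norm_heatCoeff_le hm hw) hτ z.im).congr fun p => ?_)
  rw [norm_mul, norm_e]
  simp

theorem phiF_heatCoeff (hm : 1 ≤ m) (hw : 0 < 4 * (ℓ : ℤ) * m - w ^ 2) {τ : ℂ} (hτ : 0 < τ.im)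
    (z : ℂ) :
    phiF (heatCoeff k m ℓ w) τ z =
      ((4 * (ℓ : ℂ) * (m : ℂ) - (w : ℂ) ^ 2) - (m : ℂ) * (2 * (k : ℂ) - 1) / 6 * E2 τ) *
        Qmon ℓ w τ z := by
  have hterm : ∀ j : ℕ, heatCoeff k m ℓ w (ℓ + j) w * e (((ℓ + j : ℕ) : ℂ) * τ + (w : ℂ) * z) =
      Qmon ℓ w τ z * ((heatEisCoeff k m ℓ w j : ℂ) * e ((j : ℂ) * τ)) := fun j => by
    have : ((ℓ + j : ℕ) : ℂ) * τ + (w : ℂ) * z = ((ℓ : ℂ) * τ + (w : ℂ) * z) + (j : ℂ) * τ := by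
      push_cast
      ring
    rw [heatCoeff_add, this, e_add, Qmon]
    ring
  have hinj := injective_add_mk ℓ w
  have hsum : Summable fun j : ℕ => (heatEisCoeff k m ℓ w j : ℂ) * e ((j : ℂ) * τ) :=
    (summable_mul_left_iff (by rw [Qmon]; exact Complex.exp_ne_zero _)).mp
      (((summable_heatCoeff (k := k) hm hw hτ z).comp_injective hinj).congr hterm)
  have hphi : phiF (heatCoeff k m ℓ w) τ z =
      ∑' j : ℕ, heatCoeff k m ℓ w (ℓ + j) w * e (((ℓ + j : ℕ) : ℂ) * τ + (w : ℂ) * z) :=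
    (hinj.tsum_eq fun p hp => by_contra fun h =>
      hp (by simp [heatCoeff_eq_zero_of_notMem_range h])).symm
  have hsucc : ∀ j : ℕ, (heatEisCoeff k m ℓ w (j + 1) : ℂ) * e (((j + 1 : ℕ) : ℂ) * τ) =
      4 * (m : ℂ) * (2 * (k : ℂ) - 1) * ((sigma1 (j + 1) : ℂ) * e (((j : ℂ) + 1) * τ)) :=
    fun j => by
      rw [heatEisCoeff, if_neg j.succ_ne_zero]
      push_cast
      ring
  have he : e (((0 : ℕ) : ℂ) * τ) = 1 := by simp [e]
  rw [hphi, tsum_congr hterm, tsum_mul_left, hsum.tsum_eq_zero_add, tsum_congr hsucc,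
    tsum_mul_left, he, heatEisCoeff, if_pos rfl, E2]
  push_cast
  ring

end HeatEisenstein

section Unfolding

variable {k m ℓ : ℕ} {w : ℤ} {c : ℕ → ℤ → ℂ}

theorem gaussWeight_mul_gaussWeight (t : ℝ) {y : ℝ × ℝ} (hy : 0 < y.1) :
    gaussWeight m (-1) t (k + 5 / 4) y * gaussWeight m 1 t (k - 13 / 4) y =
      y.1 ^ ((k : ℝ) - 1) * Real.exp (-4 * Real.pi * m * y.2 ^ 2 / y.1) := by
  rw [gaussWeight, gaussWeight, mul_mul_mul_comm, ← Real.rpow_add hy, ← Real.exp_add]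
  congr 2 <;> ring

theorem G11_eq (hk : 1 ≤ k) (hm : 1 ≤ m) (hw : 0 < 4 * (ℓ : ℤ) * m - w ^ 2) (t : ℝ)
    {p : ℝ × ℝ × ℝ × ℝ} (hp : 0 < p.2.1) :
    G11 k m ℓ w c p =
      (∑' q, weightedCoeff m (-1) t (k + 5 / 4) c q (p.2.1, p.2.2.2) *
        squareChar q (p.1, p.2.2.1)) *
      conj (∑' q, weightedCoeff m 1 t (k - 13 / 4) (heatCoeff k m ℓ w) q (p.2.1, p.2.2.2) *
        squareChar q (p.1, p.2.2.1)) := by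
  obtain ⟨u, v, x, y⟩ := p
  simp only at hp
  have hpow : (v : ℂ) ^ (k + 2) = ((v ^ ((k : ℝ) - 1) : ℝ) : ℂ) * (v : ℂ) ^ 3 := by
    rw [show (k : ℝ) - 1 = ((k - 1 : ℕ) : ℝ) by rw [Nat.cast_sub hk, Nat.cast_one],
      Real.rpow_natCast, Complex.ofReal_pow, ← pow_add]
    congr 1
    omega
  have hv : (v : ℂ) ≠ 0 := by exact_mod_cast hp.ne'
  have hW := congrArg (fun r : ℝ => (r : ℂ))
    (gaussWeight_mul_gaussWeight (k := k) (m := m) t (y := (v, y)) hp)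
  simp only [Complex.ofReal_mul] at hW
  rw [← phiF_mul_gaussWeight, ← phiF_mul_gaussWeight, phiF_heatCoeff hm hw hp, map_mul,
    Complex.conj_ofReal, mul_mul_mul_comm, hW, G11, hpow]
  field_simp

theorem integral_weightedCoeff_mul_conj (hk : 1 ≤ k) (hm : 1 ≤ m)
    (hw : 0 < 4 * (ℓ : ℤ) * m - w ^ 2) (j : ℕ) :
    ∫ y, weightedCoeff m (-1) (w / (2 * m)) (k + 5 / 4) c (ℓ + j, w) y *
      conj (weightedCoeff m 1 (w / (2 * m)) (k - 13 / 4) (heatCoeff k m ℓ w) (ℓ + j, w) y)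
        ∂imMeasure =
      (((m : ℝ) ^ k * Real.Gamma ((k : ℝ) + 1 / 2) / (2 * Real.pi ^ ((k : ℝ) + 1 / 2)) : ℝ) : ℂ) *
        ((heatEisCoeff k m ℓ w j : ℂ) * c (ℓ + j) w /
          (((4 * ((ℓ : ℝ) + j) * m - (w : ℝ) ^ 2) ^ ((k : ℝ) + 1 / 2) : ℝ) : ℂ)) := by
  have hm0 : (0 : ℝ) < m := by exact_mod_cast hm
  have hpi := Real.pi_pos
  have hw' : (0 : ℝ) < 4 * (ℓ : ℝ) * m - (w : ℝ) ^ 2 := by exact_mod_cast hw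
  set D : ℝ := 4 * ((ℓ : ℝ) + j) * m - (w : ℝ) ^ 2 with hD
  have hD0 : 0 < D := by
    have : (0 : ℝ) ≤ j * m := by positivity
    linarith
  have hint : ∀ y : ℝ × ℝ, 0 < y.1 →
      weightedCoeff m (-1) (w / (2 * m)) (k + 5 / 4) c (ℓ + j, w) y *
      conj (weightedCoeff m 1 (w / (2 * m)) (k - 13 / 4) (heatCoeff k m ℓ w) (ℓ + j, w) y) =
      (heatEisCoeff k m ℓ w j : ℂ) * c (ℓ + j) w * ((y.1 ^ ((k : ℝ) - 1) *
        Real.exp (-(4 * Real.pi * m) * (y.2 + w / (2 * m) * y.1) ^ 2 / y.1) *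
          Real.exp (-(Real.pi / m * D) * y.1) : ℝ) : ℂ) := fun y hy => by
    have hexp : Real.exp (-(4 * Real.pi * m) * (y.2 + w / (2 * m) * y.1) ^ 2 / y.1) *
          Real.exp (-(Real.pi / m * D) * y.1) =
        Real.exp (-2 * Real.pi * (((ℓ + j : ℕ) : ℝ) * y.1 + w * y.2)) *
          Real.exp (-2 * Real.pi * (((ℓ + j : ℕ) : ℝ) * y.1 + w * y.2)) *
          Real.exp (-4 * Real.pi * m * y.2 ^ 2 / y.1) := by
      rw [← Real.exp_add, ← Real.exp_add, ← Real.exp_add, hD]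
      congr 1
      push_cast
      field_simp
      ring
    rw [mul_assoc (y.1 ^ _), hexp, mul_left_comm (y.1 ^ _),
      ← gaussWeight_mul_gaussWeight (w / (2 * m)) hy, weightedCoeff, weightedCoeff, heatCoeff_add,
      map_mul, Complex.conj_ofReal, Complex.conj_ofReal]
    push_cast
    ring
  rw [integral_congr_ae (ae_imMeasure_pos.mono hint), integral_const_mul, integral_complex_ofReal,
    imMeasure, integral_gaussian_gamma (by positivity) (by positivity)
      (by linarith [(by exact_mod_cast hk : (1 : ℝ) ≤ k)])]
  have hval : √(Real.pi / (4 * Real.pi * m)) *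
      ((1 / (Real.pi / m * D)) ^ ((k : ℝ) - 1 + 3 / 2) * Real.Gamma ((k : ℝ) - 1 + 3 / 2)) =
      (m : ℝ) ^ k * Real.Gamma ((k : ℝ) + 1 / 2) / (2 * Real.pi ^ ((k : ℝ) + 1 / 2)) /
        D ^ ((k : ℝ) + 1 / 2) := by
    rw [show (k : ℝ) - 1 + 3 / 2 = k + 1 / 2 by ring,
      show 1 / (Real.pi / m * D) = m / (Real.pi * D) by field_simp,
      show Real.pi / (4 * Real.pi * m) = ((2 : ℝ) ^ 2 * m)⁻¹ by field_simp; norm_num,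
      Real.div_rpow hm0.le (by positivity), Real.mul_rpow hpi.le hD0.le, Real.sqrt_inv,
      Real.sqrt_mul (by norm_num), Real.sqrt_sq (by norm_num), Real.rpow_add hm0,
      Real.rpow_natCast, ← Real.sqrt_eq_rpow]
    have := Real.sqrt_pos.mpr hm0
    field_simp
  rw [hval]
  push_cast
  ring

end Unfolding

/-- absolute convergence and evaluation of the unfolded Petersson integral of a
Jacobi cusp expansion against `(L_m - (m(2k-1)/6)E₂)(q^ℓ ζ^w)`. -/
theorem statement11 (k m : ℕ) (hk : 4 < k) (hm : 1 ≤ m) (c : ℕ → ℤ → ℂ) (C : ℝ) (hC : 0 < C)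
    (hvan : ∀ (n : ℕ) (r : ℤ), 4 * (n : ℤ) * m - r ^ 2 ≤ 0 → c n r = 0)
    (hgrow : ∀ (n : ℕ) (r : ℤ), 0 < 4 * (n : ℤ) * m - r ^ 2 →
      ‖c n r‖ ≤ C * (4 * (n : ℝ) * m - (r : ℝ) ^ 2) ^ (((k : ℝ) + 1) / 2))
    (ℓ : ℕ) (hl : 1 ≤ ℓ) (w : ℤ) (hw : 0 < 4 * (ℓ : ℤ) * m - w ^ 2) :
    IntegrableOn (G11 k m ℓ w c) Reg volume ∧
    ∫ p in Reg, G11 k m ℓ w c p =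
      (((m : ℝ) ^ k * Real.Gamma ((k : ℝ) + 1 / 2) / (2 * Real.pi ^ ((k : ℝ) + 1 / 2)) : ℝ) : ℂ) *
        (((4 * (ℓ : ℂ) * (m : ℂ) - (w : ℂ) ^ 2) - (m : ℂ) * (2 * (k : ℂ) - 1) / 6) * c ℓ w /
            (((4 * (ℓ : ℝ) * m - (w : ℝ) ^ 2) ^ ((k : ℝ) + 1 / 2) : ℝ) : ℂ)
          + 4 * (m : ℂ) * (2 * (k : ℂ) - 1) *
            ∑' p : ℕ, (sigma1 (p + 1) : ℂ) * c (ℓ + p + 1) w /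
              (((4 * ((ℓ : ℝ) + (p : ℝ) + 1) * m - (w : ℝ) ^ 2) ^ ((k : ℝ) + 1 / 2) : ℝ) : ℂ)) := by
  have hk1 : 1 ≤ k := by omega
  obtain ⟨hA2, hA2s⟩ := square_integrable_weightedCoeff_cusp hm w hvan hgrow
  have hvan' := heatCoeff_eq_zero (k := k) hw
  have hgrow' := norm_heatCoeff_le (k := k) hm hw
  obtain ⟨hB2, hB2s⟩ :=
    square_integrable_weightedCoeff_single hk hm w hvan' hgrow' heatCoeff_of_ne
  obtain ⟨hI, hS⟩ := integrable_and_hasSum_integral_mul_conj (ν := squareMeasure) (P := imMeasure)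
    measurable_squareChar norm_squareChar integral_squareChar_mul_conj measurable_weightedCoeff
    (ae_imMeasure_pos.mono fun y hy => summable_norm_weightedCoeff hm hvan hgrow hy) hA2 hA2s
    measurable_weightedCoeff
    (ae_imMeasure_pos.mono fun y hy => summable_norm_weightedCoeff hm hvan' hgrow' hy) hB2 hB2s
  have hReg : MeasurableSet Reg :=
    measurableSet_Icc.prod (measurableSet_Ioi.prod (measurableSet_Icc.prod MeasurableSet.univ))
  have hG : ∀ᵐ p ∂volume.restrict Reg, G11 k m ℓ w c p = _ :=
    (ae_restrict_mem hReg).mono fun p hp => G11_eq hk1 hm hw (w / (2 * m)) hp.2.1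
  refine ⟨(measurePreserving_region.integrable_comp_of_integrable hI).congr
    (hG.mono fun p hp => hp.symm), ?_⟩
  have hint := hS
  rw [← measurePreserving_region.map_eq, integral_map
    measurePreserving_region.measurable.aemeasurable
    (by rw [measurePreserving_region.map_eq]; exact hI.aestronglyMeasurable),
    ← integral_congr_ae hG] at hint
  have hinj := injective_add_mk ℓ w
  rw [← hinj.hasSum_iff fun p hp => by
    simp [weightedCoeff, heatCoeff_eq_zero_of_notMem_range hp]] at hint
  simp only [Function.comp_def, integral_weightedCoeff_mul_conj hk1 hm hw] at hint
  rw [← hint.tsum_eq, tsum_mul_left]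
  have hpref : (((m : ℝ) ^ k * Real.Gamma ((k : ℝ) + 1 / 2) /
      (2 * Real.pi ^ ((k : ℝ) + 1 / 2)) : ℝ) : ℂ) ≠ 0 := by
    have : 0 < Real.Gamma ((k : ℝ) + 1 / 2) := Real.Gamma_pos_of_pos (by positivity)
    have : (0 : ℝ) < m := by exact_mod_cast hm
    exact_mod_cast (by positivity : (0 : ℝ) < (m : ℝ) ^ k * Real.Gamma ((k : ℝ) + 1 / 2) /
      (2 * Real.pi ^ ((k : ℝ) + 1 / 2))).ne'
  rw [((summable_mul_left_iff hpref).mp hint.summable).tsum_eq_zero_add, ← tsum_mul_left]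
  congr 2
  · simp [heatEisCoeff]
  · refine tsum_congr fun j => ?_
    rw [heatEisCoeff, if_neg j.succ_ne_zero]
    push_cast
    rw [← add_assoc (ℓ : ℝ), ← add_assoc ℓ]
    ring
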